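/- Let μ be a probability measure on G = (ℤ/2ℤ)³ with a_max = μ({0}) and a_max ≤ 1/4, and suppose μ ∈ TEC(G). Then there is a decomposition G = X₁ ⊕ X₂ (X₁ ∈ 𝔄₁, X₂ ∈ 𝔄₂, X₁ ∩ X₂ = {0}) such that: (I.1) μ(x + X₁) = 1/4 for every x ∈ X₂; and at least one of the following holds: (I.2a) μ(X₂) = 1/2; (I.2b) there is a two-element subset E ⊆ X₂ with μ(E) = μ(X₂ \ E); (I.2c) letting K⁽¹⁾, K⁽²⁾, K⁽³⁾, K⁽⁴⁾ be the four subgroups in 𝔄₂ with K⁽ʲ⁾ ∩ X₁ = {0}, there is an index j₀ such that μ ∈ U(K⁽ʲ⁰⁾) and, for every j ≠ j₀, u(K̄⁽ʲ⁾) = μ({z_j}), where z_j is the unique element of the coset K̄⁽ʲ⁾ with z_j ∉ X₁ and z_j ∉ K⁽ʲ⁰⁾. -/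

import Mathlib

open scoped BigOperators

/-- The group `G = (ℤ/2ℤ)³`. -/
abbrev G : Type := ZMod 2 × ZMod 2 × ZMod 2

/-- The character pairing `(x,y) = (-1)^(x₁y₁+x₂y₂+x₃y₃)`. -/
noncomputable def pairing (x y : G) : ℝ :=
  (-1 : ℝ) ^ (x.1.val * y.1.val + x.2.1.val * y.2.1.val + x.2.2.val * y.2.2.val)

/-- A probability measure on `G`, given by its mass function. -/
def IsProb (p : G → ℝ) : Prop := (∀ x, 0 ≤ p x) ∧ ∑ x : G, p x = 1

/-- The characteristic function `μ̂(y) = Σ_x (x,y) μ({x})`. -/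
noncomputable def charFn (p : G → ℝ) (y : G) : ℝ := ∑ x : G, pairing x y * p x

/-- The measure of a set `E ⊆ G`. -/
noncomputable def measOf (p : G → ℝ) (E : Set G) : ℝ := ∑ x : G, E.indicator p x

/-- `μ` has a trivial equivalence class: every probability measure `ν` with
`|ν̂| = |μ̂|` is a shift `μₓ` of `μ` (central symmetry is the identity on `G`). -/
def TEC (p : G → ℝ) : Prop :=
  ∀ q : G → ℝ, IsProb q → (∀ y : G, |charFn q y| = |charFn p y|) →
    ∃ x : G, ∀ e : G, q e = p (e + x)

/-- `u(E) = max_{x ∈ E} μ({x})`. -/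
noncomputable def uOf (p : G → ℝ) (E : Set G) : ℝ := sSup (p '' E)

/-- `v(E) = min_{x ∈ E} μ({x})`. -/
noncomputable def vOf (p : G → ℝ) (E : Set G) : ℝ := sInf (p '' E)

/-- `μ ∈ U(E)` iff `2 u(E) > μ(E)`. -/
def USet (p : G → ℝ) (E : Set G) : Prop := measOf p E < 2 * uOf p E

/-- `μ ∈ V(E)` iff `1/2 + 2 v(E) < μ(E)`. -/
def VSet (p : G → ℝ) (E : Set G) : Prop := 1/2 + 2 * vOf p E < measOf p E

theorem add_self_G : ∀ x : G, x + x = 0 := by decide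

theorem neg_eq_self_G : ∀ x : G, -x = x := by decide

/-- `t, a, b` is a basis of `G` over `ℤ/2ℤ`. -/
def IsBasis (t a b : G) : Prop :=
  t ≠ 0 ∧ a ≠ 0 ∧ a ≠ t ∧ b ≠ 0 ∧ b ≠ a ∧ b ≠ t ∧ b ≠ t + a

instance (t a b : G) : Decidable (IsBasis t a b) := by
  unfold IsBasis; infer_instance

theorem exists_isBasis : ∀ t : G, t ≠ 0 → ∃ a b, IsBasis t a b := by
  decide +kernel

theorem IsBasis.add_left : ∀ {t a b : G}, IsBasis t a b → IsBasis t (a + t) b := by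
  decide +kernel

theorem IsBasis.add_right : ∀ {t a b : G}, IsBasis t a b → IsBasis t a (b + t) := by
  decide +kernel

theorem IsBasis.mem_list {t a b : G} (h : IsBasis t a b) (x : G) :
    (x = 0 ∨ x = a ∨ x = b ∨ x = a + b) ∨
      (x = t ∨ x = t + a ∨ x = t + b ∨ x = t + (a + b)) := by
  have key : ∀ t a b : G, IsBasis t a b → ∀ x,
      x ∈ ({0, a, b, a + b} ∪ {t, t + a, t + b, t + (a + b)} : Finset G) := by
    decide +kernel
  simpa only [Finset.mem_union, Finset.mem_insert, Finset.mem_singleton] using key t a b h x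

theorem IsBasis.notMem_plane : ∀ {t a b : G}, IsBasis t a b →
    ¬(t = 0 ∨ t = a ∨ t = b ∨ t = a + b) := by
  decide +kernel

theorem IsBasis.plane_card : ∀ {t a b : G}, IsBasis t a b →
    ({0, a, b, a + b} : Finset G).card = 4 := by
  decide +kernel

/-- The subgroup `{0, t}`. -/
def line (t : G) : AddSubgroup G where
  carrier := {0, t}
  zero_mem' := by simp
  add_mem' := by
    rintro x y (rfl | rfl) (rfl | rfl) <;> simp [add_self_G]
  neg_mem' := by
    intro x hx
    rwa [neg_eq_self_G]

/-- The subgroup `{0, a, b, a + b}`. -/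
def plane (a b : G) : AddSubgroup G where
  carrier := {0, a, b, a + b}
  zero_mem' := by simp
  add_mem' := by
    have h2 : ∀ u v : G, u + (v + u) = v := by decide
    have h4 : ∀ u v : G, u + v + v = u := by decide
    have h5 : ∀ u v : G, u + v = v + u := add_comm
    rintro x y (rfl | rfl | rfl | rfl) (rfl | rfl | rfl | rfl) <;>
      simp [add_self_G, h2, h4, h5]
  neg_mem' := by
    intro x hx
    rwa [neg_eq_self_G]

theorem mem_line {t x : G} : x ∈ line t ↔ x = 0 ∨ x = t := Iff.rfl

theorem mem_plane {a b x : G} : x ∈ plane a b ↔ x = 0 ∨ x = a ∨ x = b ∨ x = a + b := Iff.rfl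

theorem card_line {t : G} (ht : t ≠ 0) : Nat.card (line t) = 2 := by
  change Set.ncard ({0, t} : Set G) = 2
  exact Set.ncard_pair ht.symm

theorem coe_plane (a b : G) : (plane a b : Set G) = (({0, a, b, a + b} : Finset G) : Set G) := by
  ext x
  simp [mem_plane]

theorem IsBasis.card_plane {t a b : G} (h : IsBasis t a b) : Nat.card (plane a b) = 4 := by
  change Set.ncard (plane a b : Set G) = 4
  rw [coe_plane, Set.ncard_coe_finset, h.plane_card]

theorem IsBasis.line_inf_plane {t a b : G} (h : IsBasis t a b) : line t ⊓ plane a b = ⊥ := by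
  rw [eq_bot_iff]
  rintro x ⟨hx | hx, hx'⟩
  · exact hx
  · subst hx
    exact absurd hx' h.notMem_plane

theorem IsBasis.line_sup_plane {t a b : G} (h : IsBasis t a b) : line t ⊔ plane a b = ⊤ := by
  rw [eq_top_iff]
  intro x _
  rw [AddSubgroup.mem_sup]
  have ht : t ∈ line t := mem_line.2 (Or.inr rfl)
  rcases h.mem_list x with hx | hx
  · exact ⟨0, zero_mem _, x, hx, zero_add x⟩
  · rcases hx with rfl | rfl | rfl | rfl
    · exact ⟨_, ht, 0, zero_mem _, add_zero _⟩
    all_goals exact ⟨_, ht, _, by simp [mem_plane], rfl⟩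

theorem measOf_coe (p : G → ℝ) (s : Finset G) : measOf p (s : Set G) = ∑ x ∈ s, p x := by
  classical
  simp [measOf, Set.indicator_apply]

theorem measOf_translate_line (p : G → ℝ) {t : G} (ht : t ≠ 0) (x : G) :
    measOf p ((x + ·) '' (line t : Set G)) = p x + p (x + t) := by
  have : (x + ·) '' (line t : Set G) = (({x, x + t} : Finset G) : Set G) := by
    change (x + ·) '' ({0, t} : Set G) = _
    simp [Set.image_pair]
  rw [this, measOf_coe, Finset.sum_pair (by simpa using ht)]

theorem IsBasis.sum_plane {t a b : G} (h : IsBasis t a b) (p : G → ℝ) :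
    ∑ x ∈ ({0, a, b, a + b} : Finset G), p x = p 0 + p a + p b + p (a + b) := by
  obtain ⟨-, ha, -, hb, hba, -, -⟩ := h
  rw [Finset.sum_insert, Finset.sum_insert, Finset.sum_pair]
  · ring
  · simpa using ha
  · simp [hba.symm, hb]
  · have : (0 : G) ≠ a + b := fun h0 => hba (by rw [← neg_eq_self_G a]; exact
      (neg_eq_of_add_eq_zero_right h0.symm).symm)
    simp [ha.symm, hb.symm, this]

theorem IsBasis.measOf_plane {t a b : G} (h : IsBasis t a b) (p : G → ℝ) :
    measOf p (plane a b : Set G) = p 0 + p a + p b + p (a + b) := by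
  rw [coe_plane, measOf_coe, h.sum_plane]

theorem uOf_eq_of_isMax {p : G → ℝ} {E : Set G} {z : G} (hz : z ∈ E) (h : ∀ w ∈ E, p w ≤ p z) :
    uOf p E = p z :=
  IsGreatest.csSup_eq ⟨⟨z, hz, rfl⟩, by rintro _ ⟨w, hw, rfl⟩; exact h w hw⟩

theorem add_mem_iff_of_card_eq_four {K : AddSubgroup G} (hK : Nat.card K = 4) (x y : G) :
    x + y ∈ K ↔ (x ∈ K ↔ y ∈ K) := by
  apply AddSubgroup.add_mem_iff_of_index_two
  have h := K.card_mul_index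
  have hG : Nat.card G = 8 := by rw [Nat.card_eq_fintype_card]; rfl
  rw [hK, hG] at h
  omega

/-- If the plane `⟨a, b⟩` is in `U`, the maximum over the complement of any other plane
transversal to `t` is attained outside `⟨a, b⟩` and `⟨t⟩`. -/
theorem uOf_compl_eq {p : G → ℝ} (hmax : ∀ x, p x ≤ p 0) (hle : p 0 ≤ 1 / 4) {t a b : G}
    (h : IsBasis t a b) (hp : ∀ e, p e + p (t + e) = 1 / 4)
    (hU : p a + p b + p (a + b) < p 0) {K : AddSubgroup G} (hK : Nat.card K = 4)
    (hline : line t ⊓ K = ⊥) (hne : K ≠ plane a b) {z : G} (hz : z ∉ K) (hzt : z ∉ line t)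
    (hzp : z ∉ plane a b) : uOf p (K : Set G)ᶜ = p z := by
  have ht : t ∉ K := fun htK => h.1 (by
    have : t ∈ line t ⊓ K := ⟨mem_line.2 (Or.inr rfl), htK⟩
    rwa [hline] at this)
  have hab : ¬(a ∈ K ∧ b ∈ K) := by
    rintro ⟨ha, hb⟩
    refine hne (AddSubgroup.eq_of_le_of_card_ge ?_ (by rw [hK, h.card_plane])).symm
    rintro x (rfl | rfl | rfl | rfl)
    exacts [zero_mem _, ha, hb, add_mem ha hb]
  have hadd := add_mem_iff_of_card_eq_four hK
  have h0 : (0 : G) ∈ K := zero_mem _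
  rw [mem_line] at hzt
  have hp0 := hp 0
  rw [add_zero] at hp0
  have hpa := hp a
  have hpb := hp b
  have hpc := hp (a + b)
  have hpa' := hmax (t + a)
  have hpb' := hmax (t + b)
  have hpc' := hmax (t + (a + b))
  have ha := hmax a
  have hb := hmax b
  have hc := hmax (a + b)
  refine uOf_eq_of_isMax hz fun w hw => ?_
  rw [Set.mem_compl_iff, SetLike.mem_coe] at hw
  rcases h.mem_list z with hz' | hz'
  · exact absurd hz' hzp
  rcases hz' with rfl | rfl | rfl | rfl
  · exact absurd (Or.inr rfl) hzt
  all_goals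
    rcases h.mem_list w with (rfl | rfl | rfl | rfl) | (rfl | rfl | rfl | rfl) <;>
    first
    | linarith
    | (exfalso; simp only [hadd] at hz hw; tauto)

theorem pairing_zero_right (x : G) : pairing x 0 = 1 := by simp [pairing]

theorem pairing_add_left (x x' y : G) : pairing (x + x') y = pairing x y * pairing x' y := by
  have key : ∀ x x' y : ZMod 2,
      (-1 : ℝ) ^ ((x + x').val * y.val) = (-1) ^ (x.val * y.val) * (-1) ^ (x'.val * y.val) := by
    intro x x' y
    rw [← pow_add]
    apply neg_one_pow_congr
    revert x x' y
    decide
  simp only [pairing, pow_add, Prod.fst_add, Prod.snd_add, key]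
  ring

theorem pairing_eq_or (x y : G) : pairing x y = 1 ∨ pairing x y = -1 :=
  neg_one_pow_eq_or ℝ _

theorem exists_pairing_eq_neg_one {y : G} (hy : y ≠ 0) : ∃ x, pairing x y = -1 := by
  have key : ∀ y : G, y ≠ 0 →
      ∃ x : G, Odd (x.1.val * y.1.val + x.2.1.val * y.2.1.val + x.2.2.val * y.2.2.val) := by
    decide
  obtain ⟨x, hx⟩ := key y hy
  exact ⟨x, hx.neg_one_pow⟩

theorem sum_pairing_eq_zero {y : G} (hy : y ≠ 0) : ∑ x, pairing x y = 0 := by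
  obtain ⟨x₀, hx₀⟩ := exists_pairing_eq_neg_one hy
  have := Equiv.sum_comp (Equiv.addRight x₀) (fun x => pairing x y)
  simp only [Equiv.coe_addRight, pairing_add_left, hx₀, ← Finset.sum_mul] at this
  linarith

theorem charFn_shift (p : G → ℝ) (c y : G) :
    charFn (fun x => p (x + c)) y = pairing c y * charFn p y := by
  have h := Equiv.sum_comp (Equiv.addRight c) (fun x => pairing (x + c) y * p x)
  simp only [Equiv.coe_addRight, add_assoc, add_self_G, add_zero] at h
  simp only [charFn, h, pairing_add_left, Finset.mul_sum]
  exact Finset.sum_congr rfl fun x _ => by ring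

theorem charFn_zero {p : G → ℝ} (hp : IsProb p) : charFn p 0 = 1 := by
  simp [charFn, pairing_zero_right, hp.2]

/-- Reflecting `p` at the uniform measure changes the sign of all nontrivial coefficients. -/
theorem exists_add_shift_eq {p : G → ℝ} (hp : IsProb p) (hle : ∀ x, p x ≤ 1 / 4) (htec : TEC p) :
    ∃ t : G, t ≠ 0 ∧ ∀ e, p e + p (t + e) = 1 / 4 := by
  have hq : IsProb fun x => 1 / 4 - p x := by
    refine ⟨fun x => sub_nonneg.2 (hle x), ?_⟩
    rw [Finset.sum_sub_distrib, hp.2]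
    norm_num
  obtain ⟨t, ht⟩ := htec _ hq fun y => by
    by_cases hy : y = 0
    · rw [hy, charFn_zero hp, charFn_zero hq]
    · have : charFn (fun x => 1 / 4 - p x) y = -charFn p y := by
        simp only [charFn, mul_sub, Finset.sum_sub_distrib, ← Finset.sum_mul,
          sum_pairing_eq_zero hy]
        ring
      rw [this, abs_neg]
  by_cases h0 : t = 0
  · subst h0
    have h8 : ∀ e, p e = 1 / 8 := fun e => by
      have := ht e
      simp only [add_zero] at this
      linarith
    exact ⟨(1, 0, 0), by decide, fun e => by rw [h8, h8]; norm_num⟩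
  · exact ⟨t, h0, fun e => by rw [add_comm t e, ← ht e]; ring⟩

/-- The convolution of `p` with the signed measure whose characteristic function is
`(-1)^((a,·)(b,·))`. -/
noncomputable def quadFlip (p : G → ℝ) (a b x : G) : ℝ :=
  1 / 2 * (p x + p (x + a) + p (x + b) - p (x + (a + b)))

theorem abs_charFn_quadFlip (p : G → ℝ) (a b y : G) :
    |charFn (quadFlip p a b) y| = |charFn p y| := by
  have h : charFn (quadFlip p a b) y = 1 / 2 *
      (1 + pairing a y + pairing b y - pairing a y * pairing b y) * charFn p y := by
    rw [← pairing_add_left]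
    have : charFn (quadFlip p a b) y = 1 / 2 * (charFn p y + charFn (fun x => p (x + a)) y +
        charFn (fun x => p (x + b)) y - charFn (fun x => p (x + (a + b))) y) := by
      simp only [charFn, quadFlip, ← Finset.sum_add_distrib, ← Finset.sum_sub_distrib,
        Finset.mul_sum]
      exact Finset.sum_congr rfl fun x _ => by ring
    rw [this, charFn_shift, charFn_shift, charFn_shift]
    ring
  rw [h]
  rcases pairing_eq_or a y with ha | ha <;> rcases pairing_eq_or b y with hb | hb <;>
    rw [ha, hb, abs_mul] <;> norm_num

theorem sum_quadFlip (p : G → ℝ) (a b : G) : ∑ x, quadFlip p a b x = ∑ x, p x := by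
  have h (c : G) : ∑ x, p (x + c) = ∑ x, p x := Equiv.sum_comp (Equiv.addRight c) p
  simp only [quadFlip, ← Finset.mul_sum, Finset.sum_add_distrib, Finset.sum_sub_distrib, h]
  ring

/-- If no plane transversal to `t` is in `U`, one of them has measure `1/2`. -/
theorem exists_plane_eq_half {p : G → ℝ} (hp : IsProb p) (hmax : ∀ x, p x ≤ p 0)
    (htec : TEC p) {t a b : G} (h : IsBasis t a b)
    (hpt : ∀ e, p e + p (t + e) = 1 / 4)
    (h₀ : p 0 ≤ p a + p b + p (a + b))
    (h₁ : p 0 ≤ p (t + a) + p b + p (t + (a + b)))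
    (h₂ : p 0 ≤ p a + p (t + b) + p (t + (a + b)))
    (h₃ : p 0 ≤ p (t + a) + p (t + b) + p (a + b)) :
    p 0 + p a + p b + p (a + b) = 1 / 2 ∨
    p 0 + p (t + a) + p b + p (t + (a + b)) = 1 / 2 ∨
    p 0 + p a + p (t + b) + p (t + (a + b)) = 1 / 2 ∨
    p 0 + p (t + a) + p (t + b) + p (a + b) = 1 / 2 := by
  have cancel : ∀ u v : G, u + (u + v) = v := by decide
  have comm : ∀ u v : G, u + v = v + u := add_comm
  have left_comm : ∀ u v w : G, u + (v + w) = v + (u + w) := add_left_comm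
  have hp0 := hpt 0
  rw [add_zero] at hp0
  have hpa := hpt a
  have hpb := hpt b
  have hpc := hpt (a + b)
  have hpa' := hmax (t + a)
  have hpb' := hmax (t + b)
  have hpc' := hmax (t + (a + b))
  have ha := hmax a
  have hb := hmax b
  have hc := hmax (a + b)
  have hq : IsProb (quadFlip p a b) := by
    refine ⟨fun x => ?_, by rw [sum_quadFlip, hp.2]⟩
    rcases h.mem_list x with (hx | hx | hx | hx) | (hx | hx | hx | hx) <;>
      simp only [hx, quadFlip, add_self_G, add_zero, cancel, comm, left_comm,
        add_assoc] <;>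
      linarith
  obtain ⟨s, hs⟩ := htec _ hq (abs_charFn_quadFlip p a b)
  have hs0 := hs 0
  have hsa := hs a
  have hsb := hs b
  have hsc := hs (a + b)
  clear hs
  rcases h.mem_list s with (hx | hx | hx | hx) | (hx | hx | hx | hx) <;>
    simp only [hx, quadFlip, add_self_G, add_zero, cancel, comm, left_comm,
      add_assoc] at hs0 hsa hsb hsc <;>
    first
    | (left; linarith)
    | (right; left; linarith)
    | (right; right; left; linarith)
    | (right; right; right; linarith)

/-- if `a_max = μ({0}) ≤ 1/4` and `μ ∈ TEC(G)`, then there is a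
decomposition `G = X₁ ⊕ X₂` satisfying I.1 and one of I.2(a), I.2(b), I.2(c). -/
theorem stmt7 (p : G → ℝ) (hp : IsProb p)
    (hmax : ∀ x : G, p x ≤ p 0) (hle : p 0 ≤ 1/4)
    (htec : TEC p) :
    ∃ X₁ X₂ : AddSubgroup G, Nat.card X₁ = 2 ∧ Nat.card X₂ = 4 ∧
      X₁ ⊓ X₂ = ⊥ ∧ X₁ ⊔ X₂ = ⊤ ∧
      (∀ x ∈ X₂, measOf p ((x + ·) '' (X₁ : Set G)) = 1/4) ∧
      (measOf p (X₂ : Set G) = 1/2 ∨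
       (∃ E ⊆ (X₂ : Set G), E.ncard = 2 ∧
         measOf p E = measOf p ((X₂ : Set G) \ E)) ∨
       (∃ K₀ : AddSubgroup G, Nat.card K₀ = 4 ∧ X₁ ⊓ K₀ = ⊥ ∧
         USet p (K₀ : Set G) ∧
         ∀ K : AddSubgroup G, Nat.card K = 4 → X₁ ⊓ K = ⊥ → K ≠ K₀ →
           ∀ z : G, z ∈ ((K : Set G))ᶜ → z ∉ X₁ → z ∉ K₀ →
             uOf p ((K : Set G))ᶜ = p z)) := by
  obtain ⟨t, ht, hpt⟩ := exists_add_shift_eq hp (fun x => (hmax x).trans hle) htec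
  obtain ⟨a, b, h⟩ := exists_isBasis t ht
  have hpt' : ∀ e, p e + p (e + t) = 1 / 4 := fun e => by rw [add_comm e, hpt]
  have e₁ : a + t + b = t + (a + b) := by abel
  have e₂ : a + (b + t) = t + (a + b) := by abel
  have e₃ : a + t + (b + t) = a + b := by
    rw [add_add_add_comm, add_self_G, add_zero]
  suffices ∃ a b, IsBasis t a b ∧
      (p 0 + p a + p b + p (a + b) = 1 / 2 ∨ p a + p b + p (a + b) < p 0) by
    obtain ⟨a, b, h, hS⟩ := this
    refine ⟨line t, plane a b, card_line ht, h.card_plane, h.line_inf_plane, h.line_sup_plane,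
      fun x _ => (measOf_translate_line p ht x).trans (hpt' x), ?_⟩
    rcases hS with hS | hU
    · left
      rw [h.measOf_plane, hS]
    · right; right
      refine ⟨plane a b, h.card_plane, h.line_inf_plane, ?_, fun K hK hline hne z hz hzt hzp =>
        uOf_compl_eq hmax hle h hpt hU hK hline hne hz hzt hzp⟩
      rw [USet, h.measOf_plane, uOf_eq_of_isMax (zero_mem (plane a b)) fun w _ => hmax w]
      linarith
  by_contra! hcon
  have h₀ := hcon a b h
  have h₁ := hcon (a + t) b h.add_left
  have h₂ := hcon a (b + t) h.add_right
  have h₃ := hcon (a + t) (b + t) h.add_left.add_right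
  rw [e₁, add_comm a t] at h₁
  rw [e₂, add_comm b t] at h₂
  rw [e₃, add_comm a t, add_comm b t] at h₃
  rcases exists_plane_eq_half hp hmax htec h hpt h₀.2 h₁.2 h₂.2 h₃.2 with hS | hS | hS | hS
  exacts [h₀.1 hS, h₁.1 hS, h₂.1 hS, h₃.1 hS]
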